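/- General central limit theorem for branch-number ratios: for all fixed integers q ≥ 1 and r ≥ 1, the random variables √n·(S_{q+r,n}/S_{q,n} − 1/4^r) converge in distribution, as n → ∞, to the normal distribution N(0, (4^r − 1)/(3·4^{2r−q+1})). -/

import Mathlib

open MeasureTheory ProbabilityTheory Filter
open scoped NNReal Topology

/-- Binary trees: every internal node has exactly two children. -/
inductive BinTree : Type
  | leaf : BinTree
  | node : BinTree → BinTree → BinTree
  deriving DecidableEq

namespace BinTree

/-- The magnitude of a binary tree is its number of leaves. -/
def magnitude : BinTree → ℕ
  | leaf => 1
  | node l r => magnitude l + magnitude r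

/-- The Horton–Strahler order of (the root of) a binary tree:
leaves have order 1; a node whose two children have distinct orders has the max of the two;
a node whose two children have equal order `r` has order `r + 1`. -/
def ord : BinTree → ℕ
  | leaf => 1
  | node l r => if ord l = ord r then ord l + 1 else max (ord l) (ord r)

/-- `branches k τ` is `S_{k,n}(τ)`, the number of Horton–Strahler branches of order `k`
in `τ`, i.e. the number of maximal connected paths of nodes of order `k`.  It counts the
nodes of order `k` that head a branch: a new branch head of order `ord l + 1` is created
exactly at a node whose two children have equal order `ord l`, and every leaf heads an
order-1 branch. -/
def branches (k : ℕ) : BinTree → ℕ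
  | leaf => if k = 1 then 1 else 0
  | node l r => branches k l + branches k r +
      (if ord l = ord r ∧ ord l + 1 = k then 1 else 0)

end BinTree

/-- `treesOf n` is the finite set `Ω_n` of binary trees of magnitude `n`. -/
def treesOf : ℕ → Finset BinTree
  | 0 => ∅
  | 1 => {BinTree.leaf}
  | (n+2) => (Finset.range (n+1)).attach.biUnion fun k =>
      ((treesOf (k.1+1)) ×ˢ (treesOf (n+1-k.1))).image fun p => BinTree.node p.1 p.2
  decreasing_by
  · have := Finset.mem_range.mp k.2; omega
  · omega

/-- Expectation `⟨f⟩` under the uniform probability measure `P_n` on `Ω_n` (the random model). -/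
noncomputable def expect (n : ℕ) (f : BinTree → ℝ) : ℝ :=
  (∑ τ ∈ treesOf n, f τ) / (treesOf n).card

namespace BinTree

lemma magnitude_pos : ∀ τ : BinTree, 0 < τ.magnitude
  | leaf => Nat.one_pos
  | node l _ => Nat.add_pos_left (magnitude_pos l) _

lemma ord_pos : ∀ τ : BinTree, 0 < τ.ord
  | leaf => Nat.one_pos
  | node l r => by
      have := ord_pos l
      rw [ord]
      split_ifs <;> omega

lemma ord_eq_one_iff (τ : BinTree) : τ.ord = 1 ↔ τ = leaf := by
  cases τ with
  | leaf => simp [ord]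
  | node l r =>
    have := ord_pos l
    have := ord_pos r
    simp only [ord, reduceCtorEq, iff_false]
    split_ifs <;> omega

lemma branches_one (τ : BinTree) : τ.branches 1 = τ.magnitude := by
  induction τ with
  | leaf => simp [branches, magnitude]
  | node l r hl hr =>
    have := ord_pos l
    simp only [branches, magnitude, hl, hr]
    rw [if_neg (by omega), add_zero]

/-- Removal of all leaves, followed by the contraction of the resulting chains of nodes with a
single child. The one-leaf tree is fixed. -/
def prune : BinTree → BinTree
  | leaf => leaf
  | node l r =>
      if l = leaf then prune r else if r = leaf then prune l else node (prune l) (prune r)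

lemma ord_prune {τ : BinTree} (h : τ ≠ leaf) : τ.ord = τ.prune.ord + 1 := by
  induction τ with
  | leaf => exact absurd rfl h
  | node l r hl hr =>
    have hl1 := ord_eq_one_iff l
    have hr1 := ord_eq_one_iff r
    have := ord_pos l
    have := ord_pos r
    by_cases h1 : l = leaf <;> by_cases h2 : r = leaf
    · subst h1 h2
      simp [prune, ord]
    · have := hr h2
      simp only [prune, h1, if_true, ord] at *
      rw [if_neg (by simp_all)]
      omega
    · have := hl h1
      simp only [prune, h1, h2, if_true, if_false, ord] at *
      rw [if_neg (by simp_all)]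
      omega
    · have := hl h1
      have := hr h2
      simp only [prune, h1, h2, if_false, ord]
      split_ifs <;> omega

lemma branches_succ_eq_branches_prune {τ : BinTree} (h : τ ≠ leaf) {k : ℕ} (hk : 1 ≤ k) :
    τ.branches (k + 1) = τ.prune.branches k := by
  induction τ with
  | leaf => exact absurd rfl h
  | node l r hl hr =>
    have hl1 := ord_eq_one_iff l
    have hr1 := ord_eq_one_iff r
    have hk0 : k ≠ 0 := by omega
    by_cases h1 : l = leaf <;> by_cases h2 : r = leaf
    · subst h1 h2
      simp [prune, branches, hk0, ord, eq_comm]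
    · have h3 : ¬ leaf.ord = r.ord := by rw [eq_comm]; simp [ord, hr1, h2]
      subst h1
      simp [prune, branches, hk0, h3, hr h2]
    · have h3 : ¬ l.ord = leaf.ord := by simp [ord, hl1, h1]
      subst h2
      simp [prune, branches, hk0, h3, hl h1, h1]
    · simp only [prune, h1, h2, if_false, branches, hl h1, hr h2, ord_prune h1, ord_prune h2,
        add_left_inj]

lemma magnitude_prune_le (τ : BinTree) : τ.prune.magnitude ≤ τ.magnitude := by
  induction τ with
  | leaf => exact le_rfl
  | node l r hl hr =>
    rw [prune]
    split_ifs <;> simp only [magnitude] <;> omega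

lemma mem_treesOf {n : ℕ} {τ : BinTree} : τ ∈ treesOf n ↔ τ.magnitude = n := by
  induction n using Nat.strong_induction_on generalizing τ with
  | _ n ih =>
    have hpos := magnitude_pos τ
    match n, ih with
    | 0, _ => simp [treesOf]; omega
    | 1, _ =>
      cases τ with
      | leaf => simp [treesOf, magnitude]
      | node l r =>
        have := magnitude_pos l
        have := magnitude_pos r
        simp [treesOf, magnitude]
        omega
    | n + 2, ih =>
      rw [treesOf]
      cases τ with
      | leaf => simp [magnitude]
      | node l r =>
        have h1 := magnitude_pos l
        have h2 := magnitude_pos r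
        simp only [Finset.mem_biUnion, Finset.mem_attach, Finset.mem_image, Finset.mem_product,
          true_and, Subtype.exists, Finset.mem_range, Prod.exists, node.injEq, magnitude]
        constructor
        · rintro ⟨k, hk, l', r', ⟨hl, hr⟩, rfl, rfl⟩
          rw [ih _ (by omega)] at hl hr
          omega
        · intro h
          refine ⟨l.magnitude - 1, by omega, l, r, ⟨?_, ?_⟩, rfl, rfl⟩
          · rw [ih _ (by omega)]; omega
          · rw [ih _ (by omega)]; omega

lemma treesOf_eq_biUnion {n : ℕ} (hn : n ≠ 1) :
    treesOf n = (Finset.HasAntidiagonal.antidiagonal n).biUnion fun ij =>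
      (treesOf ij.1 ×ˢ treesOf ij.2).image fun p => node p.1 p.2 := by
  ext τ
  cases τ with
  | leaf => simp [mem_treesOf, magnitude, hn.symm]
  | node l r => simp [mem_treesOf, magnitude]

lemma sum_treesOf {M : Type*} [AddCommMonoid M] {n : ℕ} (hn : n ≠ 1) (F : BinTree → M) :
    ∑ τ ∈ treesOf n, F τ = ∑ ij ∈ Finset.HasAntidiagonal.antidiagonal n,
      ∑ l ∈ treesOf ij.1, ∑ r ∈ treesOf ij.2, F (node l r) := by
  rw [treesOf_eq_biUnion hn, Finset.sum_biUnion]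
  · refine Finset.sum_congr rfl fun ij _ => ?_
    rw [Finset.sum_image, Finset.sum_product]
    rintro ⟨a, b⟩ _ ⟨c, d⟩ _ h
    simpa using h
  · rintro ⟨i, j⟩ _ ⟨i', j'⟩ _ hne
    rw [Function.onFun, Finset.disjoint_left]
    rintro τ h1 h2
    simp only [Finset.mem_image, Finset.mem_product, mem_treesOf] at h1 h2
    obtain ⟨p, ⟨h3, h4⟩, rfl⟩ := h1
    obtain ⟨p', ⟨h5, h6⟩, h7⟩ := h2
    simp only [node.injEq] at h7
    rw [h7.1] at h5
    rw [h7.2] at h6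
    exact hne (by simp [← h3, ← h4, ← h5, ← h6])

lemma treesOf_one : treesOf 1 = {leaf} := by rw [treesOf]

open PowerSeries in
/-- The generating function, by magnitude, of a weight on binary trees. -/
noncomputable def genFun (F : BinTree → ℤ) : PowerSeries ℤ :=
  PowerSeries.mk fun n => ∑ τ ∈ treesOf n, F τ

open PowerSeries in
lemma genFun_mul (A B : BinTree → ℤ) (n : ℕ) :
    coeff n (genFun A * genFun B) = ∑ ij ∈ Finset.HasAntidiagonal.antidiagonal n,
      ∑ l ∈ treesOf ij.1, ∑ r ∈ treesOf ij.2, A l * B r := by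
  simp only [coeff_mul, genFun, coeff_mk, Finset.sum_mul_sum]

/-- The indicator of the one-leaf tree. -/
def isLeaf (τ : BinTree) : ℤ := if τ = leaf then 1 else 0

/-- The indicator of the trees other than the leaf whose pruning is `σ`. -/
def pruneFiber (σ τ : BinTree) : ℤ := if τ ≠ leaf ∧ τ.prune = σ then 1 else 0

open PowerSeries in
lemma genFun_isLeaf : genFun isLeaf = X := by
  ext n
  simp [genFun, isLeaf, coeff_X, mem_treesOf, magnitude, eq_comm]

open PowerSeries in
lemma genFun_pruneFiber_leaf : (1 - 2 * X) * genFun (pruneFiber leaf) = X ^ 2 := by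
  suffices h : genFun (pruneFiber leaf) = genFun isLeaf * genFun isLeaf +
      genFun isLeaf * genFun (pruneFiber leaf) + genFun (pruneFiber leaf) * genFun isLeaf by
    rw [genFun_isLeaf] at h
    linear_combination h
  ext n
  rw [map_add, map_add, genFun_mul, genFun_mul, genFun_mul, genFun, coeff_mk]
  simp_rw [← Finset.sum_add_distrib]
  by_cases hn : n = 1
  · subst hn
    simp [treesOf_one, Finset.Nat.antidiagonal_succ, treesOf, pruneFiber]
  rw [sum_treesOf hn]
  refine Finset.sum_congr rfl fun _ _ => Finset.sum_congr rfl fun l _ =>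
    Finset.sum_congr rfl fun r _ => ?_
  by_cases h1 : l = leaf <;> by_cases h2 : r = leaf <;>
    simp [pruneFiber, isLeaf, prune, h1, h2]

open PowerSeries in
lemma genFun_pruneFiber_node (s t : BinTree) : (1 - 2 * X) * genFun (pruneFiber (node s t)) =
    genFun (pruneFiber s) * genFun (pruneFiber t) := by
  suffices h : genFun (pruneFiber (node s t)) = genFun isLeaf * genFun (pruneFiber (node s t)) +
      genFun (pruneFiber (node s t)) * genFun isLeaf +
      genFun (pruneFiber s) * genFun (pruneFiber t) by
    rw [genFun_isLeaf] at h
    linear_combination h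
  ext n
  rw [map_add, map_add, genFun_mul, genFun_mul, genFun_mul, genFun, coeff_mk]
  simp_rw [← Finset.sum_add_distrib]
  by_cases hn : n = 1
  · subst hn
    simp [treesOf_one, Finset.Nat.antidiagonal_succ, treesOf, pruneFiber]
  rw [sum_treesOf hn]
  refine Finset.sum_congr rfl fun _ _ => Finset.sum_congr rfl fun l _ =>
    Finset.sum_congr rfl fun r _ => ?_
  by_cases h1 : l = leaf <;> by_cases h2 : r = leaf <;>
    simp [pruneFiber, isLeaf, prune, h1, h2, ite_and]
  split_ifs <;> rfl

open PowerSeries in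
lemma genFun_pruneFiber (σ : BinTree) :
    (1 - 2 * X) ^ (2 * σ.magnitude - 1) * genFun (pruneFiber σ) = X ^ (2 * σ.magnitude) := by
  induction σ with
  | leaf => simpa [magnitude] using genFun_pruneFiber_leaf
  | node s t hs ht =>
    have h1 := magnitude_pos s
    have h2 := magnitude_pos t
    have h3 : 2 * (node s t).magnitude - 1 =
        (2 * s.magnitude - 1) + (2 * t.magnitude - 1) + 1 := by simp only [magnitude]; omega
    rw [h3, pow_succ, mul_assoc, genFun_pruneFiber_node, magnitude, mul_add, pow_add X, ← hs, ← ht]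
    ring

/-- The number of trees of magnitude `n` whose pruning is a given tree of magnitude `m`. -/
def pruneCount (n m : ℕ) : ℕ :=
  if 2 * m ≤ n then 2 ^ (n - 2 * m) * (n - 2).choose (2 * m - 2) else 0

open PowerSeries in
lemma sum_pruneFiber (n : ℕ) (σ : BinTree) :
    ∑ τ ∈ treesOf n, pruneFiber σ τ = pruneCount n σ.magnitude := by
  have hpos := magnitude_pos σ
  set m := σ.magnitude with hm
  have h1 : (1 - 2 * X : PowerSeries ℤ) ^ (2 * m - 1) *
      rescale 2 (invOneSubPow ℤ (2 * m - 1)).val = 1 := by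
    have := congrArg (rescale (2 : ℤ))
      (one_sub_pow_add_mul_invOneSubPow_val_eq_one_sub_pow ℤ 0 (2 * m - 1))
    simpa [rescale_X] using this
  have h2 : genFun (pruneFiber σ) =
      X ^ (2 * m) * rescale 2 (invOneSubPow ℤ (2 * m - 1)).val := by
    rw [hm, ← genFun_pruneFiber σ, ← hm]
    linear_combination (-genFun (pruneFiber σ)) * h1
  have h3 := congrArg (coeff n) h2
  rw [genFun, coeff_mk, coeff_X_pow_mul'] at h3
  rw [h3, pruneCount]
  split_ifs with h
  · obtain ⟨d, hd⟩ : ∃ d, 2 * m - 1 = d + 1 := ⟨2 * m - 2, by omega⟩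
    rw [coeff_rescale, hd, invOneSubPow_val_succ_eq_mk_add_choose, coeff_mk]
    have e1 : d + (n - 2 * m) = n - 2 := by omega
    have e2 : d = 2 * m - 2 := by omega
    rw [e1, e2]
    push_cast
    rfl
  · simp

lemma sum_comp_prune {n : ℕ} (hn : 2 ≤ n) (F : BinTree → ℂ) :
    ∑ τ ∈ treesOf n, F τ.prune =
      ∑ m ∈ Finset.range (n + 1), (pruneCount n m : ℂ) * ∑ σ ∈ treesOf m, F σ := by
  have h1 : ∀ τ ∈ treesOf n, F τ.prune = ∑ m ∈ Finset.range (n + 1), ∑ σ ∈ treesOf m,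
      (pruneFiber σ τ : ℂ) * F σ := by
    intro τ hτ
    rw [mem_treesOf] at hτ
    have h2 : τ ≠ leaf := by rintro rfl; simp [magnitude] at hτ; omega
    have h3 := magnitude_prune_le τ
    rw [Finset.sum_eq_single τ.prune.magnitude]
    · simp [pruneFiber, h2, mem_treesOf]
    · intro m _ hne
      simp [pruneFiber, h2, mem_treesOf, hne.symm]
    · intro h
      simp at h
      omega
  rw [Finset.sum_congr rfl h1, Finset.sum_comm]
  refine Finset.sum_congr rfl fun m _ => ?_
  rw [Finset.sum_comm, Finset.mul_sum]
  refine Finset.sum_congr rfl fun σ hσ => ?_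
  rw [← Finset.sum_mul, ← mem_treesOf.1 hσ]
  congr 1
  exact_mod_cast sum_pruneFiber n σ

lemma card_treesOf_succ (n : ℕ) : (treesOf (n + 1)).card = catalan n := by
  induction n using Nat.strong_induction_on with
  | _ n ih =>
    cases n with
    | zero => simp [treesOf_one]
    | succ n =>
      rw [Finset.card_eq_sum_ones, sum_treesOf (by omega), catalan_succ',
        Finset.Nat.antidiagonal_succ_succ']
      simp only [Finset.sum_const, smul_eq_mul, mul_one]
      simp [treesOf]
      refine Finset.sum_congr rfl fun ij hij => ?_
      rw [Finset.HasAntidiagonal.mem_antidiagonal] at hij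
      rw [ih _ (by omega), ih _ (by omega)]

lemma card_treesOf_pos {n : ℕ} (hn : 1 ≤ n) : 0 < (treesOf n).card := by
  obtain ⟨n, rfl⟩ := Nat.exists_eq_add_of_le' hn
  rw [card_treesOf_succ]
  refine Nat.pos_of_ne_zero fun h => ?_
  have := succ_mul_catalan_eq_centralBinom n
  simp [h] at this
  exact (Nat.centralBinom_pos n).ne this

lemma succ_mul_card_treesOf_succ {m : ℕ} (hm : 1 ≤ m) :
    (m + 1) * (treesOf (m + 1)).card = 2 * (2 * m - 1) * (treesOf m).card := by
  obtain ⟨m, rfl⟩ := Nat.exists_eq_add_of_le' hm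
  rw [card_treesOf_succ, card_treesOf_succ]
  have h1 := succ_mul_catalan_eq_centralBinom m
  have h2 := succ_mul_catalan_eq_centralBinom (m + 1)
  have h3 := Nat.succ_mul_centralBinom_succ m
  rw [← h1, ← h2] at h3
  have e : 2 * (m + 1) - 1 = 2 * m + 1 := by omega
  rw [e]
  refine Nat.eq_of_mul_eq_mul_left (Nat.succ_pos m) ?_
  linarith

lemma pruneCount_succ (n : ℕ) {m : ℕ} (hm : 1 ≤ m) :
    4 * (2 * m * (2 * m - 1)) * (pruneCount n (m + 1) : ℝ) =
      (n - 2 * m) * (n - 2 * m - 1) * pruneCount n m := by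
  obtain ⟨m, rfl⟩ := Nat.exists_eq_add_of_le' hm
  rcases lt_or_ge n (2 * (m + 1)) with h | h
  · simp [pruneCount, show ¬ 2 * (m + 1) ≤ n by omega, show ¬ 2 * (m + 1 + 1) ≤ n by omega]
  obtain ⟨k, rfl⟩ := Nat.exists_eq_add_of_le' h
  match k with
  | 0 =>
    simp [pruneCount]
  | 1 =>
    simp [pruneCount, show ¬ 2 * (m + 1 + 1) ≤ 1 + 2 * (m + 1) by omega]
  | k + 2 =>
    have e1 : k + 2 + 2 * (m + 1) - 2 * (m + 1 + 1) = k := by omega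
    have e2 : k + 2 + 2 * (m + 1) - 2 * (m + 1) = k + 2 := by omega
    have e3 : k + 2 + 2 * (m + 1) - 2 = k + 2 + 2 * m := by omega
    have e4 : 2 * (m + 1 + 1) - 2 = 2 * m + 2 := by omega
    have e5 : 2 * (m + 1) - 2 = 2 * m := by omega
    rw [pruneCount, pruneCount, if_pos (by omega), if_pos (by omega), e1, e2, e3, e4, e5]
    have h1 := Nat.choose_succ_right_eq (k + 2 + 2 * m) (2 * m)
    have h2 := Nat.choose_succ_right_eq (k + 2 + 2 * m) (2 * m + 1)
    rw [show k + 2 + 2 * m - 2 * m = k + 2 by omega] at h1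
    rw [show k + 2 + 2 * m - (2 * m + 1) = k + 1 by omega] at h2
    have h1' : ((k + 2 + 2 * m).choose (2 * m + 1) : ℝ) * (2 * m + 1) =
        (k + 2 + 2 * m).choose (2 * m) * (k + 2) := by exact_mod_cast h1
    have h2' : ((k + 2 + 2 * m).choose (2 * m + 2) : ℝ) * (2 * m + 2) =
        (k + 2 + 2 * m).choose (2 * m + 1) * (k + 1) := by exact_mod_cast h2
    push_cast
    rw [pow_add]
    linear_combination (4 * 2 ^ k * (2 * m + 1) : ℝ) * h2' + (4 * 2 ^ k * (k + 1) : ℝ) * h1'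

/-- The complex-valued version of `expect`. -/
noncomputable def treeMean (n : ℕ) (F : BinTree → ℂ) : ℂ :=
  (∑ τ ∈ treesOf n, F τ) / (treesOf n).card

/-- The probability that the pruning of a uniform tree of magnitude `n` has magnitude `m`. -/
noncomputable def pruneProb (n m : ℕ) : ℝ :=
  pruneCount n m * (treesOf m).card / (treesOf n).card

lemma treeMean_congr {n : ℕ} {F G : BinTree → ℂ} (h : ∀ τ, τ.magnitude = n → F τ = G τ) :
    treeMean n F = treeMean n G := by
  rw [treeMean, treeMean, Finset.sum_congr rfl fun τ hτ => h τ (mem_treesOf.1 hτ)]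

lemma treeMean_const_mul (n : ℕ) (c : ℂ) (F : BinTree → ℂ) :
    treeMean n (fun τ => c * F τ) = c * treeMean n F := by
  rw [treeMean, treeMean, ← Finset.mul_sum, mul_div_assoc]

lemma treeMean_const {n : ℕ} (hn : 1 ≤ n) (c : ℂ) : treeMean n (fun _ => c) = c := by
  have : ((treesOf n).card : ℂ) ≠ 0 := by exact_mod_cast (card_treesOf_pos hn).ne'
  rw [treeMean, Finset.sum_const, nsmul_eq_mul, mul_div_cancel_left₀ _ this]

lemma norm_treeMean_le_one (n : ℕ) {F : BinTree → ℂ} (h : ∀ τ, ‖F τ‖ ≤ 1) :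
    ‖treeMean n F‖ ≤ 1 := by
  rw [treeMean, norm_div, Complex.norm_natCast]
  refine div_le_one_of_le₀ ((norm_sum_le _ _).trans ?_) (Nat.cast_nonneg _)
  exact (Finset.sum_le_sum fun τ _ => h τ).trans (by simp)

lemma treeMean_comp_prune {n : ℕ} (hn : 2 ≤ n) (F : BinTree → ℂ) :
    treeMean n (fun τ => F τ.prune) =
      ∑ m ∈ Finset.range (n + 1), (pruneProb n m : ℂ) * treeMean m F := by
  rw [treeMean, sum_comp_prune hn, Finset.sum_div]
  refine Finset.sum_congr rfl fun m _ => ?_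
  rw [pruneProb, treeMean]
  rcases Nat.eq_zero_or_pos m with rfl | hm
  · simp [treesOf]
  · have : ((treesOf m).card : ℂ) ≠ 0 := by exact_mod_cast (card_treesOf_pos hm).ne'
    push_cast
    field_simp

lemma pruneProb_nonneg (n m : ℕ) : 0 ≤ pruneProb n m := by
  unfold pruneProb
  positivity

lemma pruneProb_zero (n : ℕ) : pruneProb n 0 = 0 := by
  simp [pruneProb, treesOf]

lemma sum_pruneProb {n : ℕ} (hn : 2 ≤ n) : ∑ m ∈ Finset.range (n + 1), pruneProb n m = 1 := by
  have h := treeMean_comp_prune hn fun _ => 1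
  rw [treeMean_const (by omega)] at h
  have h1 : (1 : ℂ) = ∑ m ∈ Finset.range (n + 1), (pruneProb n m : ℂ) := by
    rw [h]
    refine Finset.sum_congr rfl fun m _ => ?_
    rcases Nat.eq_zero_or_pos m with rfl | hm
    · simp [pruneProb_zero]
    · rw [treeMean_const hm, mul_one]
  exact_mod_cast h1.symm

lemma pruneProb_succ (n m : ℕ) :
    pruneProb n (m + 1) * (4 * (m + 1) * m) =
      pruneProb n m * ((n - 2 * m) * (n - 2 * m - 1)) := by
  rcases Nat.eq_zero_or_pos m with rfl | hm
  · simp [pruneProb_zero]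
  have h1 := pruneCount_succ n hm
  have h2 : ((m : ℝ) + 1) * (treesOf (m + 1)).card = 2 * (2 * m - 1) * (treesOf m).card := by
    have := succ_mul_card_treesOf_succ hm
    have h3 : ((2 * m - 1 : ℕ) : ℝ) = 2 * m - 1 := by
      rw [Nat.cast_sub (by omega)]; simp
    rw [← h3]
    exact_mod_cast this
  have h4 : (2 * (2 * m - 1) : ℝ) ≠ 0 := by
    have : (1 : ℝ) ≤ m := by exact_mod_cast hm
    linarith
  rw [pruneProb, pruneProb, div_mul_eq_mul_div, div_mul_eq_mul_div]
  congr 1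
  refine mul_left_cancel₀ h4 ?_
  linear_combination (4 * m * 2 * (2 * m - 1) * pruneCount n (m + 1) : ℝ) * h2 +
    (2 * (2 * m - 1) * (treesOf m).card : ℝ) * h1

/-- A Stein-type identity characterizing the law of the magnitude of a pruned random tree. -/
lemma sum_pruneProb_stein (n : ℕ) {E : Type*} [AddCommGroup E] [Module ℝ E] (g : ℕ → E) :
    ∑ m ∈ Finset.range (n + 1), (pruneProb n m * ((n - 2 * m) * (n - 2 * m - 1))) • g (m + 1) =
      ∑ m ∈ Finset.range (n + 1), (pruneProb n m * (4 * m * (m - 1))) • g m := by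
  have h0 : pruneProb n (n + 1) = 0 := by
    rw [pruneProb, pruneCount, if_neg (by omega)]
    simp
  have h1 : ∑ m ∈ Finset.range (n + 2), (pruneProb n m * (4 * m * (m - 1))) • g m =
      ∑ m ∈ Finset.range (n + 1), (pruneProb n m * (4 * m * (m - 1))) • g m := by
    rw [Finset.sum_range_succ, h0, zero_mul, zero_smul, add_zero]
  rw [← h1]
  conv_rhs => rw [Finset.sum_range_succ']
  simp only [pruneProb_zero, zero_mul, zero_smul, add_zero]
  refine Finset.sum_congr rfl fun m _ => ?_
  rw [← pruneProb_succ]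
  congr 1
  push_cast
  ring

/-- The standardized deviation of `m` from `n / 4`. -/
noncomputable def dev (n m : ℕ) : ℝ := √n * (m / n - 1 / 4)

lemma dev_succ {n : ℕ} (hn : 1 ≤ n) (m : ℕ) : dev n (m + 1) = dev n m + 1 / √n := by
  have h : (0 : ℝ) < √n := Real.sqrt_pos.2 (by exact_mod_cast hn)
  have h2 : (n : ℝ) = √n ^ 2 := (Real.sq_sqrt n.cast_nonneg).symm
  rw [dev, dev]
  set s := √(n : ℝ)
  rw [h2]
  push_cast
  field_simp
  ring

lemma up_weight_eq {n : ℕ} (hn : 1 ≤ n) (m : ℕ) :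
    ((n - 2 * m) * (n - 2 * m - 1) : ℝ) = √n ^ 3 * (√n / 4 - 2 * dev n m +
      4 / √n * dev n m ^ 2 - 1 / √n / 2 + 2 * (1 / √n) ^ 2 * dev n m) := by
  have h : (0 : ℝ) < √n := Real.sqrt_pos.2 (by exact_mod_cast hn)
  have h2 : (n : ℝ) = √n ^ 2 := (Real.sq_sqrt n.cast_nonneg).symm
  rw [dev]
  set s := √(n : ℝ)
  rw [h2]
  field_simp
  ring

lemma down_weight_eq {n : ℕ} (hn : 1 ≤ n) (m : ℕ) :
    (4 * m * (m - 1) : ℝ) = √n ^ 3 * (√n / 4 + 2 * dev n m +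
      4 / √n * dev n m ^ 2 - 1 / √n - 4 * (1 / √n) ^ 2 * dev n m) := by
  have h : (0 : ℝ) < √n := Real.sqrt_pos.2 (by exact_mod_cast hn)
  have h2 : (n : ℝ) = √n ^ 2 := (Real.sq_sqrt n.cast_nonneg).symm
  rw [dev]
  set s := √(n : ℝ)
  rw [h2]
  field_simp
  ring

lemma sum_pruneProb_stein_dev {n : ℕ} (hn : 1 ≤ n) {E : Type*} [AddCommGroup E] [Module ℝ E]
    (g : ℕ → E) :
    ∑ m ∈ Finset.range (n + 1), pruneProb n m •
      ((√n / 4 - 2 * dev n m + 4 / √n * dev n m ^ 2 - 1 / √n / 2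
        + 2 * (1 / √n) ^ 2 * dev n m) • g (m + 1) -
      (√n / 4 + 2 * dev n m + 4 / √n * dev n m ^ 2 - 1 / √n
        - 4 * (1 / √n) ^ 2 * dev n m) • g m) = 0 := by
  have h : (√n ^ 3 : ℝ) ≠ 0 := (pow_pos (Real.sqrt_pos.2 (by exact_mod_cast hn)) 3).ne'
  have h1 := sum_pruneProb_stein n g
  rw [← sub_eq_zero, ← Finset.sum_sub_distrib] at h1
  refine (smul_eq_zero_iff_right h).1 ?_
  rw [← h1, Finset.smul_sum]
  refine Finset.sum_congr rfl fun m _ => ?_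
  rw [up_weight_eq hn, down_weight_eq hn]
  module

lemma sum_pruneProb_mul_dev_sq_le {n : ℕ} (hn : 10 ≤ n) :
    ∑ m ∈ Finset.range (n + 1), pruneProb n m * dev n m ^ 2 ≤ 1 := by
  have h : (0 : ℝ) < √n := Real.sqrt_pos.2 (by exact_mod_cast (by omega : 0 < n))
  have h1 := sum_pruneProb_stein_dev (by omega : 1 ≤ n) (dev n)
  have h2 : ∑ m ∈ Finset.range (n + 1), pruneProb n m • (2 - 2 * dev n m ^ 2) ≥ 0 := by
    rw [← h1]
    refine Finset.sum_le_sum fun m _ => ?_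
    refine smul_le_smul_of_nonneg_left ?_ (pruneProb_nonneg n m)
    rw [dev_succ (by omega)]
    set y := dev n m
    set k := 1 / √(n : ℝ) with hk
    have hk0 : 0 < k := by positivity
    have hk1 : k ^ 2 ≤ 1 / 10 := by
      rw [hk, div_pow, Real.sq_sqrt n.cast_nonneg, one_pow]
      exact one_div_le_one_div_of_le (by norm_num) (by exact_mod_cast hn)
    have hk2 : k ≤ 1 / 3 := by nlinarith
    have e : √(n : ℝ) = 1 / k := by rw [hk]; simp
    have e2 : 4 / √(n : ℝ) = 4 * k := by rw [hk]; ring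
    rw [e2, e]
    simp only [smul_eq_mul]
    have e3 : (1 / k / 4 - 2 * y + 4 * k * y ^ 2 - k / 2 + 2 * k ^ 2 * y) * (y + k) -
        (1 / k / 4 + 2 * y + 4 * k * y ^ 2 - k - 4 * k ^ 2 * y) * y =
        -4 * y ^ 2 + 10 * k ^ 2 * y ^ 2 + 1 / 4 - k ^ 2 / 2 + (-(3 / 2) * k + 2 * k ^ 3) * y := by
      field_simp
      ring
    rw [e3]
    have h4 : k ^ 2 * y ^ 2 ≤ 1 / 10 * y ^ 2 := mul_le_mul_of_nonneg_right hk1 (sq_nonneg y)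
    have h5 : |(-(3 / 2) * k + 2 * k ^ 3) * y| ≤ 1 * |y| := by
      rw [abs_mul]
      refine mul_le_mul_of_nonneg_right ?_ (abs_nonneg _)
      rw [abs_le]
      have : k ^ 3 ≤ 1 / 10 * k := by
        rw [pow_succ]; exact mul_le_mul_of_nonneg_right hk1 hk0.le
      have : 0 < k ^ 3 := by positivity
      constructor <;> linarith
    have h6 := (abs_le.1 h5).2
    have h7 : |y| ≤ (1 + y ^ 2) / 2 := by nlinarith [sq_nonneg (|y| - 1), sq_abs y]
    nlinarith [sq_nonneg k, sq_nonneg y]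
  have h3 : ∑ m ∈ Finset.range (n + 1), pruneProb n m • (2 - 2 * dev n m ^ 2) =
      2 - 2 * ∑ m ∈ Finset.range (n + 1), pruneProb n m * dev n m ^ 2 := by
    calc _ = 2 * ∑ m ∈ Finset.range (n + 1), pruneProb n m -
          2 * ∑ m ∈ Finset.range (n + 1), pruneProb n m * dev n m ^ 2 := by
          rw [Finset.mul_sum, Finset.mul_sum, ← Finset.sum_sub_distrib]
          refine Finset.sum_congr rfl fun m _ => ?_
          rw [smul_eq_mul]
          ring
      _ = _ := by rw [sum_pruneProb (by omega : 2 ≤ n), mul_one]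
  linarith

/-- The characteristic function of the standardized magnitude of a pruned random tree. -/
noncomputable def pruneChar (n : ℕ) (t : ℝ) : ℂ :=
  ∑ m ∈ Finset.range (n + 1), (pruneProb n m : ℂ) * Complex.exp (t * dev n m * Complex.I)

open Complex in
lemma hasDerivAt_pruneChar (n : ℕ) (t : ℝ) :
    HasDerivAt (pruneChar n) (∑ m ∈ Finset.range (n + 1),
      (pruneProb n m : ℂ) * (exp (t * dev n m * I) * (dev n m * I))) t := by
  refine HasDerivAt.fun_sum fun m _ => HasDerivAt.const_mul _ ?_
  have h1 : HasDerivAt (fun s : ℝ => (s : ℂ) * dev n m * I) (dev n m * I) t := by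
    simpa using ((hasDerivAt_id t).ofReal_comp.mul_const (dev n m : ℂ)).mul_const I
  exact h1.cexp

open Complex in
lemma norm_stein_remainder_le {k t y : ℝ} (hk : 0 < k) (hk1 : k ≤ 1) (htk : |t| * k ≤ 1) :
    ‖((1 / k / 4 - 2 * y + 4 * k * y ^ 2 - k / 2 + 2 * k ^ 2 * y : ℝ) : ℂ) * exp (t * k * I) -
      ((1 / k / 4 + 2 * y + 4 * k * y ^ 2 - k - 4 * k ^ 2 * y : ℝ) : ℂ) -
      (t * I / 4 - 4 * y)‖ ≤ 8 * k * (1 + t ^ 2) * (1 + y ^ 2) := by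
  set e := exp (t * k * I) with he
  have hkc : (k : ℂ) ≠ 0 := by exact_mod_cast hk.ne'
  have h1 : ‖e - 1‖ ≤ |t| * k := by
    have := Real.norm_exp_I_mul_ofReal_sub_one_le (x := t * k)
    rw [Real.norm_eq_abs, abs_mul, abs_of_pos hk] at this
    convert this using 3
    rw [he]
    push_cast
    ring_nf
  have hn : ‖(t * k * I : ℂ)‖ = |t| * k := by simp [abs_of_pos hk]
  have h2 : ‖e - 1 - t * k * I‖ ≤ (|t| * k) ^ 2 := by
    rw [← hn]
    exact norm_exp_sub_one_sub_id_le (by rw [hn]; exact htk)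
  have e1 : ((1 / k / 4 - 2 * y + 4 * k * y ^ 2 - k / 2 + 2 * k ^ 2 * y : ℝ) : ℂ) * e -
      ((1 / k / 4 + 2 * y + 4 * k * y ^ 2 - k - 4 * k ^ 2 * y : ℝ) : ℂ) -
      (t * I / 4 - 4 * y) = ((k / 2 + 6 * k ^ 2 * y : ℝ) : ℂ) +
      ((1 / (4 * k) : ℝ) : ℂ) * (e - 1 - t * k * I) +
      ((-2 * y + 4 * k * y ^ 2 - k / 2 + 2 * k ^ 2 * y : ℝ) : ℂ) * (e - 1) := by
    push_cast
    field_simp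
    ring
  have hy : |y| ≤ (1 + y ^ 2) / 2 := by nlinarith [sq_nonneg (|y| - 1), sq_abs y]
  have ht : |t| ≤ (1 + t ^ 2) / 2 := by nlinarith [sq_nonneg (|t| - 1), sq_abs t]
  have hkk : k ^ 2 ≤ k := by nlinarith
  have b1 : ‖((k / 2 + 6 * k ^ 2 * y : ℝ) : ℂ)‖ ≤ k * (4 * (1 + y ^ 2)) := by
    rw [norm_real, Real.norm_eq_abs]
    calc |k / 2 + 6 * k ^ 2 * y| ≤ |k / 2| + |6 * k ^ 2 * y| := abs_add_le _ _
      _ = k / 2 + 6 * k ^ 2 * |y| := by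
        rw [abs_of_pos (by positivity : 0 < k / 2), abs_mul, abs_of_pos (by positivity)]
      _ ≤ k / 2 + 6 * k * |y| := by gcongr
      _ ≤ k / 2 + 6 * k * ((1 + y ^ 2) / 2) := by gcongr
      _ ≤ _ := by nlinarith [sq_nonneg y, mul_nonneg hk.le (sq_nonneg y)]
  have b2 : ‖((1 / (4 * k) : ℝ) : ℂ) * (e - 1 - t * k * I)‖ ≤ k * t ^ 2 := by
    rw [norm_mul, norm_real, Real.norm_eq_abs, abs_of_pos (by positivity)]
    calc 1 / (4 * k) * ‖e - 1 - t * k * I‖ ≤ 1 / (4 * k) * (|t| * k) ^ 2 := by gcongr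
      _ = k * t ^ 2 / 4 := by rw [mul_pow, sq_abs]; field_simp
      _ ≤ _ := by nlinarith [mul_nonneg hk.le (sq_nonneg t)]
  have b3 : ‖((-2 * y + 4 * k * y ^ 2 - k / 2 + 2 * k ^ 2 * y : ℝ) : ℂ) * (e - 1)‖ ≤
      (6 * (1 + y ^ 2)) * ((1 + t ^ 2) / 2 * k) := by
    rw [norm_mul, norm_real, Real.norm_eq_abs]
    refine mul_le_mul ?_ (h1.trans (by gcongr)) (norm_nonneg _) (by positivity)
    have c1 : k * y ^ 2 ≤ y ^ 2 := mul_le_of_le_one_left (sq_nonneg y) hk1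
    have c2 : |2 * k ^ 2 * y| ≤ 2 * |y| := by
      rw [abs_mul, abs_of_pos (by positivity)]
      exact mul_le_mul_of_nonneg_right (by linarith) (abs_nonneg _)
    have c3 := abs_le.1 c2
    have c4 := neg_abs_le y
    have c5 := le_abs_self y
    have c6 : 0 ≤ k * y ^ 2 := by positivity
    rw [abs_le]
    constructor <;> nlinarith [c3.1, c3.2]
  rw [e1]
  refine (norm_add₃_le.trans (add_le_add (add_le_add b1 b2) b3)).trans ?_
  have d1 : 0 ≤ k * t ^ 2 := by positivity
  have d2 : 0 ≤ k * y ^ 2 := by positivity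
  have d3 : 0 ≤ k * t ^ 2 * y ^ 2 := by positivity
  nlinarith

open Complex in
lemma norm_deriv_pruneChar_add_le {n : ℕ} (hn : 10 ≤ n) {t : ℝ} (ht : |t| ≤ √n) :
    ‖(∑ m ∈ Finset.range (n + 1), (pruneProb n m : ℂ) * (exp (t * dev n m * I) * (dev n m * I))) +
      t / 16 * pruneChar n t‖ ≤ 4 * (1 + t ^ 2) / √n := by
  have h : (0 : ℝ) < √n := Real.sqrt_pos.2 (by exact_mod_cast (by omega : 0 < n))
  have h1 := sum_pruneProb_stein_dev (by omega : 1 ≤ n) fun m => exp (t * dev n m * I)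
  set k := 1 / √(n : ℝ) with hk
  have hk0 : 0 < k := by positivity
  have hk1 : k ≤ 1 := by
    rw [hk, div_le_one h, Real.one_le_sqrt]
    exact_mod_cast (by omega : 1 ≤ n)
  have e : √(n : ℝ) = 1 / k := by rw [hk]; simp
  have e2 : 4 / √(n : ℝ) = 4 * k := by rw [hk]; ring
  have htk : |t| * k ≤ 1 := by rw [hk, mul_one_div, div_le_one h]; exact ht
  rw [e2] at h1
  rw [e] at h1
  have key : (∑ m ∈ Finset.range (n + 1),
        (pruneProb n m : ℂ) * (exp (t * dev n m * I) * (dev n m * I))) + t / 16 * pruneChar n t =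
      I / 4 * ∑ m ∈ Finset.range (n + 1), (pruneProb n m : ℂ) * (exp (t * dev n m * I) *
        (((1 / k / 4 - 2 * dev n m + 4 * k * dev n m ^ 2 - k / 2 + 2 * k ^ 2 * dev n m : ℝ) : ℂ) *
          exp (t * k * I) -
        ((1 / k / 4 + 2 * dev n m + 4 * k * dev n m ^ 2 - k - 4 * k ^ 2 * dev n m : ℝ) : ℂ) -
        (t * I / 4 - 4 * dev n m))) := by
    rw [pruneChar, Finset.mul_sum, ← Finset.sum_add_distrib, Finset.mul_sum, ← sub_eq_zero,
      ← Finset.sum_sub_distrib]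
    have h2 := congrArg (fun z : ℂ => -I / 4 * z) h1
    simp only [mul_zero, Finset.mul_sum] at h2
    refine (Finset.sum_congr rfl fun m _ => ?_).trans h2
    have e3 : exp (t * dev n (m + 1) * I) = exp (t * dev n m * I) * exp (t * k * I) := by
      rw [dev_succ (by omega), ← hk, ← exp_add]
      push_cast
      ring_nf
    rw [e3]
    simp only [real_smul]
    linear_combination ((pruneProb n m : ℂ) * exp (t * dev n m * I) * t / 16) * I_sq
  rw [key, norm_mul]
  have hI : ‖(I / 4 : ℂ)‖ = 1 / 4 := by simp
  rw [hI]
  have bound : ∑ m ∈ Finset.range (n + 1),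
      pruneProb n m * (8 * k * (1 + t ^ 2) * (1 + dev n m ^ 2)) ≤ 16 * k * (1 + t ^ 2) := by
    have s1 := sum_pruneProb (by omega : 2 ≤ n)
    have s2 := sum_pruneProb_mul_dev_sq_le hn
    calc _ = 8 * k * (1 + t ^ 2) * (∑ m ∈ Finset.range (n + 1), pruneProb n m +
          ∑ m ∈ Finset.range (n + 1), pruneProb n m * dev n m ^ 2) := by
          rw [← Finset.sum_add_distrib, Finset.mul_sum]
          exact Finset.sum_congr rfl fun m _ => by ring
      _ ≤ 8 * k * (1 + t ^ 2) * (1 + 1) := by rw [s1]; gcongr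
      _ = _ := by ring
  calc _ ≤ 1 / 4 * (16 * k * (1 + t ^ 2)) := by
        refine mul_le_mul_of_nonneg_left (le_trans ?_ bound) (by norm_num)
        refine (norm_sum_le _ _).trans (Finset.sum_le_sum fun m _ => ?_)
        rw [norm_mul, norm_mul, norm_real, Real.norm_of_nonneg (pruneProb_nonneg n m)]
        have hex : ‖exp (t * dev n m * I)‖ = 1 := by
          exact_mod_cast norm_exp_ofReal_mul_I (t * dev n m)
        rw [hex, one_mul]
        exact mul_le_mul_of_nonneg_left (norm_stein_remainder_le hk0 hk1 htk)
          (pruneProb_nonneg n m)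
    _ = _ := by rw [hk]; ring

open Complex in
lemma norm_pruneChar_sub_le {n : ℕ} (hn : 10 ≤ n) {T t : ℝ} (hT : T ≤ √n) (ht : |t| ≤ T) :
    ‖pruneChar n t - exp (-(t ^ 2 / 32 : ℝ))‖ ≤
      Real.exp (T ^ 2 / 32) * (4 * (1 + T ^ 2)) * T / √n := by
  have h : (0 : ℝ) < √n := Real.sqrt_pos.2 (by exact_mod_cast (by omega : 0 < n))
  have hT0 : 0 ≤ T := (abs_nonneg t).trans ht
  let d (s : ℝ) : ℂ := ∑ m ∈ Finset.range (n + 1),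
    (pruneProb n m : ℂ) * (exp (s * dev n m * I) * (dev n m * I))
  have hd : ∀ s : ℝ, HasDerivAt (fun s : ℝ => exp ((s ^ 2 / 32 : ℝ) : ℂ) * pruneChar n s)
      (exp ((s ^ 2 / 32 : ℝ) : ℂ) * (d s + s / 16 * pruneChar n s)) s := by
    intro s
    have h1 : HasDerivAt (fun s : ℝ => ((s ^ 2 / 32 : ℝ) : ℂ)) ((2 * s / 32 : ℝ) : ℂ) s := by
      refine HasDerivAt.ofReal_comp ?_
      simpa using (hasDerivAt_pow 2 s).div_const 32
    have h2 : HasDerivAt (pruneChar n) (d s) s := hasDerivAt_pruneChar n s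
    refine (h1.cexp.mul h2).congr_deriv ?_
    generalize d s = a
    push_cast
    ring
  have hb : ∀ s ∈ Set.Icc (-T) T, ‖exp ((s ^ 2 / 32 : ℝ) : ℂ) * (d s + s / 16 * pruneChar n s)‖ ≤
      Real.exp (T ^ 2 / 32) * (4 * (1 + T ^ 2)) / √n := by
    intro s hs
    have hs1 : |s| ≤ T := abs_le.2 hs
    have hs2 : s ^ 2 ≤ T ^ 2 := by rw [← sq_abs s]; gcongr
    rw [norm_mul, ← ofReal_exp, norm_real, Real.norm_of_nonneg (Real.exp_pos _).le, mul_div_assoc]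
    refine mul_le_mul (by gcongr) ?_ (norm_nonneg _) (Real.exp_pos _).le
    exact (norm_deriv_pruneChar_add_le hn (hs1.trans hT)).trans (by gcongr)
  have h0 : pruneChar n 0 = 1 := by
    simp only [pruneChar, ofReal_zero, zero_mul, exp_zero, mul_one]
    exact_mod_cast sum_pruneProb (by omega : 2 ≤ n)
  have key := (convex_Icc (-T) T).norm_image_sub_le_of_norm_hasDerivWithin_le
    (fun s _ => (hd s).hasDerivWithinAt) hb
    (⟨by linarith, hT0⟩ : (0 : ℝ) ∈ Set.Icc (-T) T) (abs_le.1 ht : t ∈ Set.Icc (-T) T)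
  rw [h0, sub_zero, Real.norm_eq_abs] at key
  simp only [ne_eq, OfNat.ofNat_ne_zero, not_false_eq_true, zero_pow, zero_div, ofReal_zero,
    exp_zero, mul_one] at key
  have e : pruneChar n t - exp (-(t ^ 2 / 32 : ℝ)) = exp (-(t ^ 2 / 32 : ℝ)) *
      (exp ((t ^ 2 / 32 : ℝ) : ℂ) * pruneChar n t - 1) := by
    rw [mul_sub, ← mul_assoc, ← exp_add, neg_add_cancel, exp_zero]
    ring
  have e2 : ‖exp (-(t ^ 2 / 32 : ℝ))‖ ≤ 1 := by
    rw [← ofReal_neg, ← ofReal_exp, norm_real, Real.norm_of_nonneg (Real.exp_pos _).le,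
      Real.exp_le_one_iff]
    linarith [sq_nonneg t]
  rw [e, norm_mul]
  calc _ ≤ 1 * (Real.exp (T ^ 2 / 32) * (4 * (1 + T ^ 2)) / √n * |t|) := by gcongr
    _ ≤ 1 * (Real.exp (T ^ 2 / 32) * (4 * (1 + T ^ 2)) / √n * T) := by gcongr
    _ = _ := by ring

lemma tendsto_sqrt_natCast : Tendsto (fun n : ℕ => √(n : ℝ)) atTop atTop :=
  Real.tendsto_sqrt_atTop.comp tendsto_natCast_atTop_atTop

open Complex in
lemma tendsto_pruneChar (t : ℝ) :
    Tendsto (fun x : ℕ × ℝ => pruneChar x.1 x.2) (atTop ×ˢ 𝓝 t)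
      (𝓝 (exp (-(t ^ 2 / 32 : ℝ)))) := by
  have h1 : Tendsto (fun x : ℕ × ℝ => exp (-(x.2 ^ 2 / 32 : ℝ))) (atTop ×ˢ 𝓝 t)
      (𝓝 (exp (-(t ^ 2 / 32 : ℝ)))) :=
    (Continuous.tendsto (f := fun s : ℝ => exp (-(s ^ 2 / 32 : ℝ))) (by fun_prop) t).comp
      tendsto_snd
  have h2 : Tendsto (fun x : ℕ × ℝ => pruneChar x.1 x.2 - exp (-(x.2 ^ 2 / 32 : ℝ)))
      (atTop ×ˢ 𝓝 t) (𝓝 0) := by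
    set T := |t| + 1
    refine squeeze_zero_norm' (a := fun x : ℕ × ℝ =>
      Real.exp (T ^ 2 / 32) * (4 * (1 + T ^ 2)) * T / √x.1) ?_ ?_
    · have a1 : ∀ᶠ n : ℕ in atTop, 10 ≤ n ∧ T ≤ √(n : ℝ) :=
        (eventually_ge_atTop 10).and (tendsto_sqrt_natCast.eventually_ge_atTop T)
      have a2 : ∀ᶠ s in 𝓝 t, |s| ≤ T :=
        (continuous_abs.tendsto t).eventually_le_const (by simp [T])
      filter_upwards [a1.prod_mk a2] with x hx
      exact norm_pruneChar_sub_le hx.1.1 hx.1.2 hx.2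
    · exact (tendsto_const_nhds.div_atTop tendsto_sqrt_natCast).comp tendsto_fst
  simpa using h2.add h1

lemma tendsto_average {Ψ : ℕ → ℝ → ℂ} (hΨ : ∀ n t, ‖Ψ n t‖ ≤ 1) {k : ℝ → ℝ}
    (hk : ContinuousAt k (1 / 4)) {t : ℝ} {z : ℂ}
    (h : Tendsto (fun x : ℕ × ℝ => Ψ x.1 x.2) (atTop ×ˢ 𝓝 (t * k (1 / 4))) (𝓝 z)) :
    Tendsto (fun x : ℕ × ℝ => ∑ m ∈ Finset.range (x.1 + 1),
      pruneProb x.1 m * ‖Ψ m (x.2 * k (m / x.1)) - z‖) (atTop ×ˢ 𝓝 t) (𝓝 0) := by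
  have hz : ‖z‖ ≤ 1 := le_of_tendsto h.norm (Eventually.of_forall fun x => hΨ _ _)
  have hm : Tendsto (fun y : (ℕ × ℝ) × ℕ => (y.2, y.1.2 * k (y.2 / y.1.1)))
      (((atTop ×ˢ 𝓝 t) ×ˢ ⊤) ⊓ comap (fun y => (y.2 / y.1.1 : ℝ)) (𝓝 (1 / 4)))
      (atTop ×ˢ 𝓝 (t * k (1 / 4))) := by
    have q1 : Tendsto (fun y : (ℕ × ℝ) × ℕ => (y.2 / y.1.1 : ℝ))
        (((atTop ×ˢ 𝓝 t) ×ˢ ⊤) ⊓ comap (fun y => (y.2 / y.1.1 : ℝ)) (𝓝 (1 / 4))) (𝓝 (1 / 4)) :=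
      tendsto_comap.mono_left inf_le_right
    have q2 : Tendsto (fun y : (ℕ × ℝ) × ℕ => y.1)
        (((atTop ×ˢ 𝓝 t) ×ˢ ⊤) ⊓ comap (fun y => (y.2 / y.1.1 : ℝ)) (𝓝 (1 / 4)))
        (atTop ×ˢ 𝓝 t) :=
      tendsto_fst.mono_left inf_le_left
    have q3 := tendsto_fst.comp q2
    refine Tendsto.prodMk ?_ ((tendsto_snd.comp q2).mul (hk.tendsto.comp q1))
    rw [← tendsto_natCast_atTop_iff (R := ℝ)]
    refine ((tendsto_natCast_atTop_atTop (R := ℝ)).comp q3 |>.atTop_mul_pos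
      (by norm_num : (0 : ℝ) < 1 / 4) q1).congr' ?_
    filter_upwards [q3.eventually_ge_atTop 1] with y hy
    have : (y.1.1 : ℝ) ≠ 0 := by exact_mod_cast (Nat.one_le_iff_ne_zero.1 hy)
    simp only [Function.comp]
    field_simp
  have hD := h.comp hm
  rw [Metric.tendsto_nhds]
  intro ε hε
  obtain ⟨s, hs, u, hu, hsu⟩ :=
    eventually_inf.1 ((Metric.tendsto_nhds.1 hD) (ε / 2) (by linarith))
  obtain ⟨v, hv, hvu⟩ := hu
  obtain ⟨η, hη, hηv⟩ := Metric.mem_nhds_iff.1 hv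
  rw [mem_prod_top] at hs
  have hlarge : ∀ᶠ x : ℕ × ℝ in atTop ×ˢ 𝓝 t, 10 ≤ x.1 ∧ 2 / (x.1 * η ^ 2) < ε / 2 := by
    have : Tendsto (fun n : ℕ => 2 / ((n : ℝ) * η ^ 2)) atTop (𝓝 0) :=
      tendsto_const_nhds.div_atTop
        (tendsto_natCast_atTop_atTop.atTop_mul_const (by positivity))
    exact tendsto_fst.eventually
      ((eventually_ge_atTop 10).and (this.eventually_lt_const (half_pos hε)))
  filter_upwards [hs, hlarge] with x hx hx2
  obtain ⟨n, r⟩ := x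
  obtain ⟨hn, hnε⟩ := hx2
  simp only at hn hnε ⊢
  have hn0 : (0 : ℝ) < n := by exact_mod_cast (by omega : 0 < n)
  rw [dist_zero_right, Real.norm_of_nonneg (Finset.sum_nonneg fun m _ =>
    mul_nonneg (pruneProb_nonneg _ _) (norm_nonneg _))]
  have hterm : ∀ m : ℕ, ‖Ψ m (r * k (m / n)) - z‖ ≤ ε / 2 + 2 / (n * η ^ 2) * dev n m ^ 2 := by
    intro m
    have hdev : dev n m ^ 2 = n * (m / n - 1 / 4 : ℝ) ^ 2 := by
      rw [dev, mul_pow, Real.sq_sqrt hn0.le]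
    by_cases hclose : |(m / n - 1 / 4 : ℝ)| < η
    · have := hsu ((n, r), m) ⟨hx m, hvu (hηv (by simpa [Real.dist_eq] using hclose))⟩
      rw [Function.comp, dist_eq_norm] at this
      have h0 : 0 ≤ 2 / (n * η ^ 2) * dev n m ^ 2 := by positivity
      linarith
    · have h1 : ‖Ψ m (r * k (m / n)) - z‖ ≤ 2 := by
        refine (norm_sub_le _ _).trans ?_
        linarith [hΨ m (r * k (m / n))]
      have h2 : η ^ 2 ≤ (m / n - 1 / 4 : ℝ) ^ 2 := by
        rw [← sq_abs (m / n - 1 / 4 : ℝ)]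
        exact pow_le_pow_left₀ hη.le (not_lt.1 hclose) 2
      have h3 : 2 ≤ 2 / (n * η ^ 2) * dev n m ^ 2 := by
        rw [hdev, div_mul_eq_mul_div, le_div_iff₀ (by positivity)]
        nlinarith
      linarith
  calc _ ≤ ∑ m ∈ Finset.range (n + 1),
        pruneProb n m * (ε / 2 + 2 / (n * η ^ 2) * dev n m ^ 2) :=
        Finset.sum_le_sum fun m _ =>
          mul_le_mul_of_nonneg_left (hterm m) (pruneProb_nonneg n m)
    _ = ε / 2 * ∑ m ∈ Finset.range (n + 1), pruneProb n m + 2 / (n * η ^ 2) *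
        ∑ m ∈ Finset.range (n + 1), pruneProb n m * dev n m ^ 2 := by
        rw [Finset.mul_sum, Finset.mul_sum, ← Finset.sum_add_distrib]
        exact Finset.sum_congr rfl fun m _ => by ring
    _ ≤ ε / 2 * 1 + 2 / (n * η ^ 2) * 1 := by
        rw [sum_pruneProb (by omega : 2 ≤ n)]
        gcongr
        exact sum_pruneProb_mul_dev_sq_le hn
    _ < ε := by linarith

/-- The characteristic function of the rescaled ratio of the numbers of branches of orders
`q + r` and `q`. -/
noncomputable def ratioChar (q r n : ℕ) (t : ℝ) : ℂ :=
  treeMean n fun τ => Complex.exp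
    (t * (√n * ((τ.branches (q + r) : ℝ) / τ.branches q - 1 / 4 ^ r) : ℝ) * Complex.I)

lemma norm_ratioChar_le_one (q r n : ℕ) (t : ℝ) : ‖ratioChar q r n t‖ ≤ 1 := by
  refine norm_treeMean_le_one n fun τ => ?_
  rw [← Complex.ofReal_mul, Complex.norm_exp_ofReal_mul_I]

open Complex in
lemma ratioChar_one_succ {n : ℕ} (hn : 2 ≤ n) (r : ℕ) (t : ℝ) :
    ratioChar 1 (r + 1) n t = ∑ m ∈ Finset.range (n + 1), (pruneProb n m : ℂ) *
      (exp ((t / 4 ^ r : ℝ) * dev n m * I) * ratioChar 1 r m (t * √(m / n))) := by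
  have h1 : ratioChar 1 (r + 1) n t = treeMean n fun τ => exp
      (t * (√n * ((τ.prune.branches (1 + r) : ℝ) / n - 1 / 4 ^ (r + 1)) : ℝ) * I) := by
    refine treeMean_congr fun τ hτ => ?_
    have h2 : τ ≠ leaf := by rintro rfl; simp [magnitude] at hτ; omega
    rw [← add_assoc, branches_succ_eq_branches_prune h2 (by omega), branches_one, hτ]
  rw [h1, treeMean_comp_prune hn fun τ => exp
      (t * (√n * ((τ.branches (1 + r) : ℝ) / n - 1 / 4 ^ (r + 1)) : ℝ) * I)]
  refine Finset.sum_congr rfl fun m _ => ?_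
  rcases Nat.eq_zero_or_pos m with rfl | hm
  · simp [pruneProb_zero]
  congr 1
  rw [ratioChar, ← treeMean_const_mul]
  refine treeMean_congr fun τ hτ => ?_
  rw [branches_one, hτ, ← exp_add, ← add_mul]
  congr 2
  norm_cast
  have hn0 : (0 : ℝ) < √n := Real.sqrt_pos.2 (by exact_mod_cast (by omega : 0 < n))
  have hm0 : (0 : ℝ) < √m := Real.sqrt_pos.2 (by exact_mod_cast hm)
  rw [dev, Real.sqrt_div m.cast_nonneg]
  have e1 : (n : ℝ) = √n ^ 2 := (Real.sq_sqrt n.cast_nonneg).symm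
  have e2 : (m : ℝ) = √m ^ 2 := (Real.sq_sqrt m.cast_nonneg).symm
  set a := √(n : ℝ)
  set b := √(m : ℝ)
  rw [e1, e2]
  push_cast
  field_simp
  ring

open Complex in
lemma ratioChar_succ {n : ℕ} (hn : 2 ≤ n) {q : ℕ} (hq : 1 ≤ q) (r : ℕ) (t : ℝ) :
    ratioChar (q + 1) r n t = ∑ m ∈ Finset.range (n + 1), (pruneProb n m : ℂ) *
      ratioChar q r m (t * (√(m / n))⁻¹) := by
  have h1 : ratioChar (q + 1) r n t = treeMean n fun τ => exp
      (t * (√n * ((τ.prune.branches (q + r) : ℝ) / τ.prune.branches q - 1 / 4 ^ r) : ℝ) * I) := by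
    refine treeMean_congr fun τ hτ => ?_
    have h2 : τ ≠ leaf := by rintro rfl; simp [magnitude] at hτ; omega
    rw [add_right_comm, branches_succ_eq_branches_prune h2 (by omega),
      branches_succ_eq_branches_prune h2 hq]
  rw [h1, treeMean_comp_prune hn fun τ => exp
      (t * (√n * ((τ.branches (q + r) : ℝ) / τ.branches q - 1 / 4 ^ r) : ℝ) * I)]
  refine Finset.sum_congr rfl fun m _ => ?_
  rcases Nat.eq_zero_or_pos m with rfl | hm
  · simp [pruneProb_zero]
  congr 1
  refine treeMean_congr fun τ _ => ?_
  congr 2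
  have hm0 : (0 : ℝ) < √m := Real.sqrt_pos.2 (by exact_mod_cast hm)
  rw [Real.sqrt_div m.cast_nonneg]
  norm_cast
  field_simp

lemma sqrt_one_div_four : √(1 / 4 : ℝ) = 1 / 2 := by
  rw [show (1 / 4 : ℝ) = (1 / 2) ^ 2 by norm_num]
  exact Real.sqrt_sq (by norm_num)

lemma eventually_two_le_fst (t : ℝ) : ∀ᶠ x : ℕ × ℝ in atTop ×ˢ 𝓝 t, 2 ≤ x.1 :=
  tendsto_fst.eventually (eventually_ge_atTop 2)

open Complex in
lemma tendsto_ratioChar_one (r : ℕ) (t : ℝ) :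
    Tendsto (fun x : ℕ × ℝ => ratioChar 1 r x.1 x.2) (atTop ×ˢ 𝓝 t)
      (𝓝 (exp (-((4 ^ r - 1) / (3 * 16 ^ r) * t ^ 2 / 2 : ℝ)))) := by
  induction r generalizing t with
  | zero =>
    refine tendsto_const_nhds.congr' ?_
    filter_upwards [eventually_two_le_fst t] with x hx
    rw [ratioChar, treeMean_congr (G := fun _ => 1), treeMean_const (by omega)]
    · simp
    · intro τ hτ
      have : (x.1 : ℝ) ≠ 0 := by exact_mod_cast (by omega : x.1 ≠ 0)
      simp [branches_one, hτ, this]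
  | succ r ih =>
    have hk : ContinuousAt (fun u : ℝ => √u) (1 / 4) := by fun_prop
    have h1 := tendsto_average (norm_ratioChar_le_one 1 r) hk (ih (t * √(1 / 4)))
    set z := exp (-((4 ^ r - 1) / (3 * 16 ^ r) * (t * √(1 / 4)) ^ 2 / 2 : ℝ)) with hz
    have h2 : Tendsto (fun x : ℕ × ℝ => pruneChar x.1 (x.2 / 4 ^ r) * z) (atTop ×ˢ 𝓝 t)
        (𝓝 (exp (-((t / 4 ^ r) ^ 2 / 32 : ℝ)) * z)) :=
      ((tendsto_pruneChar (t / 4 ^ r)).comp (tendsto_fst.prodMk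
        ((tendsto_snd (f := atTop) (g := 𝓝 t)).div_const (4 ^ r)))).mul_const z
    have h3 : exp (-((t / 4 ^ r) ^ 2 / 32 : ℝ)) * z =
        exp (-((4 ^ (r + 1) - 1) / (3 * 16 ^ (r + 1)) * t ^ 2 / 2 : ℝ)) := by
      have h16 : (16 : ℝ) ^ r = (4 ^ r) ^ 2 := by rw [← pow_mul, mul_comm, pow_mul]; norm_num
      have h4 : (4 : ℝ) ^ r ≠ 0 := by positivity
      have e : -((t / 4 ^ r) ^ 2 / 32) + -((4 ^ r - 1) / (3 * 16 ^ r) * (t * (1 / 2)) ^ 2 / 2) =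
          -((4 ^ (r + 1) - 1) / (3 * 16 ^ (r + 1)) * t ^ 2 / 2) := by
        rw [pow_succ 4 r, pow_succ 16 r, h16]
        generalize (4 : ℝ) ^ r = a at h4
        field_simp
        ring
      rw [hz, ← exp_add, sqrt_one_div_four]
      exact_mod_cast congrArg (fun x : ℝ => exp (x : ℂ)) e
    rw [← h3]
    have h4 : Tendsto (fun x : ℕ × ℝ => ratioChar 1 (r + 1) x.1 x.2 -
        pruneChar x.1 (x.2 / 4 ^ r) * z) (atTop ×ˢ 𝓝 t) (𝓝 0) := by
      refine squeeze_zero_norm' ?_ h1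
      filter_upwards [eventually_two_le_fst t] with x hx
      rw [ratioChar_one_succ hx, pruneChar, Finset.sum_mul, ← Finset.sum_sub_distrib]
      refine (norm_sum_le _ _).trans (Finset.sum_le_sum fun m _ => ?_)
      rw [← mul_assoc (pruneProb x.1 m : ℂ), ← mul_sub, norm_mul, norm_mul, norm_real,
        Real.norm_of_nonneg (pruneProb_nonneg _ _), ← ofReal_mul, norm_exp_ofReal_mul_I, mul_one]
    simpa using h4.add h2

open Complex in
lemma tendsto_ratioChar (q r : ℕ) (t : ℝ) :
    Tendsto (fun x : ℕ × ℝ => ratioChar (q + 1) r x.1 x.2) (atTop ×ˢ 𝓝 t)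
      (𝓝 (exp (-((4 ^ r - 1) / (3 * 16 ^ r) * 4 ^ q * t ^ 2 / 2 : ℝ)))) := by
  induction q generalizing t with
  | zero => simpa using tendsto_ratioChar_one r t
  | succ q ih =>
    have hk : ContinuousAt (fun u : ℝ => (√u)⁻¹) (1 / 4) :=
      Real.continuous_sqrt.continuousAt.inv₀ (by rw [sqrt_one_div_four]; norm_num)
    have h1 := tendsto_average (norm_ratioChar_le_one (q + 1) r) hk (ih (t * (√(1 / 4))⁻¹))
    have h3 : exp (-((4 ^ r - 1) / (3 * 16 ^ r) * 4 ^ q * (t * (√(1 / 4))⁻¹) ^ 2 / 2 : ℝ)) =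
        exp (-((4 ^ r - 1) / (3 * 16 ^ r) * 4 ^ (q + 1) * t ^ 2 / 2 : ℝ)) := by
      rw [sqrt_one_div_four]
      congr 3
      ring
    rw [h3] at h1
    set z := exp (-((4 ^ r - 1) / (3 * 16 ^ r) * 4 ^ (q + 1) * t ^ 2 / 2 : ℝ))
    rw [tendsto_iff_norm_sub_tendsto_zero]
    refine squeeze_zero' (Eventually.of_forall fun _ => norm_nonneg _) ?_ h1
    filter_upwards [eventually_two_le_fst t] with x hx
    have hs : z = ∑ m ∈ Finset.range (x.1 + 1), (pruneProb x.1 m : ℂ) * z := by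
      rw [← Finset.sum_mul, ← ofReal_sum, sum_pruneProb hx, ofReal_one, one_mul]
    rw [ratioChar_succ hx (by omega)]
    nth_rewrite 1 [hs]
    rw [← Finset.sum_sub_distrib]
    refine (norm_sum_le _ _).trans (Finset.sum_le_sum fun m _ => ?_)
    rw [← mul_sub, norm_mul, norm_real, Real.norm_of_nonneg (pruneProb_nonneg _ _)]

/-- The law of a statistic of a uniform tree of magnitude `n`. -/
noncomputable def treeLaw (n : ℕ) (Y : BinTree → ℝ) : Measure ℝ :=
  ∑ τ ∈ treesOf n, ENNReal.ofReal ((treesOf n).card : ℝ)⁻¹ • Measure.dirac (Y τ)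

lemma isProbabilityMeasure_treeLaw {n : ℕ} (hn : 1 ≤ n) (Y : BinTree → ℝ) :
    IsProbabilityMeasure (treeLaw n Y) := by
  have h : (0 : ℝ) < (treesOf n).card := by exact_mod_cast card_treesOf_pos hn
  constructor
  simp only [treeLaw, Measure.coe_finsetSum, Finset.sum_apply, Measure.smul_apply,
    measure_univ, smul_eq_mul, mul_one, Finset.sum_const, nsmul_eq_mul]
  rw [← ENNReal.ofReal_natCast, ← ENNReal.ofReal_mul h.le, mul_inv_cancel₀ h.ne',
    ENNReal.ofReal_one]

lemma integral_treeLaw {E : Type*} [NormedAddCommGroup E] [NormedSpace ℝ E] [CompleteSpace E]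
    (n : ℕ) (Y : BinTree → ℝ) (f : ℝ → E) :
    ∫ x, f x ∂(treeLaw n Y) = ((treesOf n).card : ℝ)⁻¹ • ∑ τ ∈ treesOf n, f (Y τ) := by
  rw [treeLaw, integral_finsetSum_measure]
  · simp [integral_smul_measure, Finset.smul_sum]
  · exact fun τ _ => (integrable_dirac (by simp)).smul_measure ENNReal.ofReal_ne_top

end BinTree

/-- General CLT for branch-number ratios: for `q, r ≥ 1`,
`√n (S_{q+r,n}/S_{q,n} − 1/4^r)` converges in distribution to
`N(0, (4^r − 1)/(3·4^{2r−q+1}))`.  The ratio is `0` when `S_{q,n} = 0`. -/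
theorem clt_general_ratio (q r : ℕ) (hq : 1 ≤ q) (hr : 1 ≤ r) :
    ∀ f : BoundedContinuousFunction ℝ ℝ,
      Tendsto (fun n : ℕ => expect n (fun τ =>
          f (Real.sqrt n *
            ((BinTree.branches (q+r) τ : ℝ) / (BinTree.branches q τ : ℝ) - 1 / 4 ^ r))))
        atTop (𝓝 (∫ x, f x ∂(gaussianReal 0
          (((4 : ℝ≥0) ^ r - 1) /
            (3 * (4 : ℝ≥0) ^ (2 * (r : ℤ) - (q : ℤ) + 1)))))) := by
  intro f
  set v : ℝ≥0 := ((4 : ℝ≥0) ^ r - 1) / (3 * (4 : ℝ≥0) ^ (2 * (r : ℤ) - (q : ℤ) + 1)) with hv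
  obtain ⟨q, rfl⟩ := Nat.exists_eq_add_of_le' hq
  have hvr : (v : ℝ) = (4 ^ r - 1) / (3 * 16 ^ r) * 4 ^ q := by
    have h4 : (1 : ℝ≥0) ≤ 4 ^ r := one_le_pow₀ (by norm_num)
    have e : (2 * (r : ℤ) - ((q + 1 : ℕ) : ℤ) + 1) = 2 * (r : ℤ) - q := by push_cast; ring
    have h16 : (4 : ℝ) ^ (2 * (r : ℤ)) = 16 ^ r := by
      rw [zpow_mul, zpow_natCast]
      norm_num
    rw [hv, e, NNReal.coe_div, NNReal.coe_sub h4]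
    push_cast
    rw [zpow_sub₀ (by norm_num), h16, zpow_natCast]
    field_simp
  let Y (n : ℕ) (τ : BinTree) : ℝ :=
    √n * ((τ.branches (q + 1 + r) : ℝ) / τ.branches (q + 1) - 1 / 4 ^ r)
  let μ (n : ℕ) : ProbabilityMeasure ℝ :=
    ⟨BinTree.treeLaw (n + 1) (Y (n + 1)), BinTree.isProbabilityMeasure_treeLaw (by omega) _⟩
  let γ : ProbabilityMeasure ℝ := ⟨gaussianReal 0 v, inferInstance⟩
  have hμ : Tendsto μ atTop (𝓝 γ) := by
    refine ProbabilityMeasure.tendsto_of_tendsto_charFun fun t => ?_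
    have h1 : ∀ n, charFun (μ n : Measure ℝ) t = BinTree.ratioChar (q + 1) r (n + 1) t := by
      intro n
      rw [charFun_apply_real]
      refine (BinTree.integral_treeLaw _ _ _).trans ?_
      rw [BinTree.ratioChar, BinTree.treeMean, div_eq_inv_mul, Complex.real_smul]
      simp only [Y]
      push_cast
      rfl
    have h2 : charFun (γ : Measure ℝ) t =
        Complex.exp (-((4 ^ r - 1) / (3 * 16 ^ r) * 4 ^ q * t ^ 2 / 2 : ℝ)) := by
      refine (charFun_gaussianReal t).trans ?_
      rw [← hvr]
      push_cast
      congr 1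
      ring
    have h3 : Tendsto (fun n : ℕ => (n + 1, t)) atTop (atTop ×ˢ 𝓝 t) :=
      (tendsto_add_atTop_nat 1).prodMk tendsto_const_nhds
    have h4 := (BinTree.tendsto_ratioChar q r t).comp h3
    rw [h2]
    exact h4.congr fun n => (h1 n).symm
  have h := ProbabilityMeasure.tendsto_iff_forall_integral_tendsto.1 hμ f
  have e : ∀ n, ∫ x, f x ∂(μ n : Measure ℝ) = expect (n + 1) (fun τ => f (Y (n + 1) τ)) := by
    intro n
    refine (BinTree.integral_treeLaw (n + 1) (Y (n + 1)) f).trans ?_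
    rw [expect, div_eq_inv_mul, smul_eq_mul]
  simp only [e] at h
  exact (tendsto_add_atTop_iff_nat (f := fun n => expect n (fun τ => f (Y n τ))) 1).1 h
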